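/- arXiv:2302.01772 — 3 statements merged into one kernel-verified Lean document; each statement's English description precedes it below -/
import Mathlib

section
/- Let n be a positive integer and f an integer with 0 ≤ f < n/2. The coordinate-wise trimmed mean CWTM is (f,κ)-robust with κ = (6f/(n−2f))·(1 + f/(n−2f)). -/
theorem Finset.sum_le_sum_of_card_le_of_forall_le {ι : Type*} {A B : Finset ι} {g : ι → ℝ}
    (hg : ∀ i, 0 ≤ g i) (hcard : A.card ≤ B.card) (hle : ∀ a ∈ A, ∀ b ∈ B, g a ≤ g b) :
    ∑ i ∈ A, g i ≤ ∑ i ∈ B, g i := by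
  rcases A.eq_empty_or_nonempty with rfl | hA
  · simpa using Finset.sum_nonneg fun i _ => hg i
  · obtain ⟨a, ha, hmax⟩ := A.exists_max_image g hA
    calc ∑ i ∈ A, g i ≤ A.card • g a := Finset.sum_le_card_nsmul _ _ _ hmax
      _ ≤ B.card • g a := nsmul_le_nsmul_left (hg a) hcard
      _ ≤ ∑ i ∈ B, g i := Finset.card_nsmul_le_sum _ _ _ (hle a ha)

/-- Every kept value outside `S` lies between the low and the high trimmed values inside `S`,
and there are enough of the latter on either side to dominate the squares. -/
theorem sum_sq_kept_sdiff_le {n f : ℕ} (hf : 2 * f < n) {z : Fin n → ℝ} (hz : Monotone z)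
    {S : Finset (Fin n)} (hS : S.card = n - f) :
    ∑ j ∈ Finset.univ.filter (fun j : Fin n => f ≤ (j : ℕ) ∧ (j : ℕ) < n - f) \ S, z j ^ 2 ≤
      ∑ j ∈ S \ Finset.univ.filter (fun j : Fin n => f ≤ (j : ℕ) ∧ (j : ℕ) < n - f), z j ^ 2 := by
  set T := Finset.univ.filter (fun j : Fin n => f ≤ (j : ℕ) ∧ (j : ℕ) < n - f) with hT
  set L := Finset.univ.filter (fun j : Fin n => (j : ℕ) < f) with hL
  set H := Finset.univ.filter (fun j : Fin n => n - f ≤ (j : ℕ)) with hH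
  have hLcard : L.card = f := by
    rw [hL, Fin.card_filter_val_lt]; omega
  have hHcard : H.card = f := by
    have h := Finset.card_filter_add_card_filter_not (s := (Finset.univ : Finset (Fin n)))
      (fun j : Fin n => (j : ℕ) < n - f)
    simp only [not_lt, Fin.card_filter_val_lt, Finset.card_univ, Fintype.card_fin] at h
    rw [← hH] at h
    omega
  have hcompl : Sᶜ.card = f := by
    rw [Finset.card_compl, hS, Fintype.card_fin]; omega
  have key : ∀ U : Finset (Fin n), U.card = f → Disjoint T U → (T \ S).card ≤ (U ∩ S).card := by
    intro U hU hTU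
    have h1 : ((T \ S) ∪ (U \ S)).card ≤ Sᶜ.card := by
      apply Finset.card_le_card
      intro j
      simp only [Finset.mem_union, Finset.mem_sdiff, Finset.mem_compl]
      tauto
    rw [Finset.card_union_of_disjoint
      (hTU.mono Finset.sdiff_subset Finset.sdiff_subset), hcompl] at h1
    have h2 := Finset.card_sdiff_add_card_inter U S
    omega
  have hTL : Disjoint T L := by
    rw [Finset.disjoint_left]; intro j; simp only [hT, hL, Finset.mem_filter]; omega
  have hTH : Disjoint T H := by
    rw [Finset.disjoint_left]; intro j; simp only [hT, hH, Finset.mem_filter]; omega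
  have hpos : ∑ j ∈ T \ S, (max (z j) 0) ^ 2 ≤ ∑ j ∈ H ∩ S, (max (z j) 0) ^ 2 := by
    refine Finset.sum_le_sum_of_card_le_of_forall_le (fun _ => sq_nonneg _) (key H hHcard hTH) ?_
    intro a ha b hb
    have hab : z a ≤ z b := hz <| by
      simp only [hT, hH, Finset.mem_filter, Finset.mem_sdiff, Finset.mem_inter] at ha hb
      rw [Fin.le_def]; omega
    gcongr
  have hneg : ∑ j ∈ T \ S, (max (-z j) 0) ^ 2 ≤ ∑ j ∈ L ∩ S, (max (-z j) 0) ^ 2 := by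
    refine Finset.sum_le_sum_of_card_le_of_forall_le (fun _ => sq_nonneg _) (key L hLcard hTL) ?_
    intro a ha b hb
    have hab : z b ≤ z a := hz <| by
      simp only [hT, hL, Finset.mem_filter, Finset.mem_sdiff, Finset.mem_inter] at ha hb
      rw [Fin.le_def]; omega
    gcongr
  have hsplit : ∀ t : ℝ, t ^ 2 = (max t 0) ^ 2 + (max (-t) 0) ^ 2 := by
    intro t
    rcases le_total 0 t with h | h <;> simp [h]
  have hLH : Disjoint (H ∩ S) (L ∩ S) := by
    rw [Finset.disjoint_left]; intro j
    simp only [hH, hL, Finset.mem_filter, Finset.mem_inter]; omega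
  calc ∑ j ∈ T \ S, z j ^ 2
      = ∑ j ∈ T \ S, (max (z j) 0) ^ 2 + ∑ j ∈ T \ S, (max (-z j) 0) ^ 2 := by
        rw [← Finset.sum_add_distrib]; exact Finset.sum_congr rfl fun j _ => hsplit _
    _ ≤ ∑ j ∈ H ∩ S, z j ^ 2 + ∑ j ∈ L ∩ S, z j ^ 2 := by
        refine add_le_add (hpos.trans ?_) (hneg.trans ?_) <;>
        · refine Finset.sum_le_sum fun j _ => ?_
          rw [hsplit (z j)]
          simp only [le_add_iff_nonneg_right, le_add_iff_nonneg_left, sq_nonneg]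
    _ = ∑ j ∈ (H ∩ S) ∪ (L ∩ S), z j ^ 2 := (Finset.sum_union hLH).symm
    _ ≤ ∑ j ∈ S \ T, z j ^ 2 := by
        refine Finset.sum_le_sum_of_subset_of_nonneg ?_ fun _ _ _ => sq_nonneg _
        intro j
        simp only [hT, hL, hH, Finset.mem_union, Finset.mem_inter, Finset.mem_filter,
          Finset.mem_sdiff, Finset.mem_univ, true_and]
        rintro (⟨h, hj⟩ | ⟨h, hj⟩) <;> exact ⟨hj, by omega⟩

theorem card_filter_kept {n f : ℕ} (hf : 2 * f < n) :
    (Finset.univ.filter (fun j : Fin n => f ≤ (j : ℕ) ∧ (j : ℕ) < n - f)).card = n - 2 * f := by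
  rw [← Finset.card_map Fin.valEmbedding]
  have : (Finset.univ.filter (fun j : Fin n => f ≤ (j : ℕ) ∧ (j : ℕ) < n - f)).map
      Fin.valEmbedding = Finset.Ico f (n - f) := by
    ext i
    simp only [Finset.mem_map, Finset.mem_filter, Finset.mem_univ, true_and,
      Fin.valEmbedding_apply, Finset.mem_Ico]
    constructor
    · rintro ⟨j, hj, rfl⟩; exact hj
    · intro hi; exact ⟨⟨i, by omega⟩, hi, rfl⟩
  rw [this, Nat.card_Ico]
  omega

theorem sq_sum_kept_le {n f : ℕ} (hf : 2 * f < n) {z : Fin n → ℝ} (hz : Monotone z)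
    {S : Finset (Fin n)} (hS : S.card = n - f) (hzero : ∑ j ∈ S, z j = 0) :
    (∑ j ∈ Finset.univ.filter (fun j : Fin n => f ≤ (j : ℕ) ∧ (j : ℕ) < n - f), z j) ^ 2 ≤
      6 * f * ∑ j ∈ S, z j ^ 2 := by
  have hPQ := sum_sq_kept_sdiff_le hf hz hS
  have hTcard := card_filter_kept hf
  set T := Finset.univ.filter (fun j : Fin n => f ≤ (j : ℕ) ∧ (j : ℕ) < n - f)
  have hTS : ((T \ S).card : ℝ) ≤ f := by
    have h : (T \ S).card ≤ Sᶜ.card := Finset.card_le_card fun j => by simp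
    rw [Finset.card_compl, hS, Fintype.card_fin] at h
    exact_mod_cast h.trans (by omega)
  have hST : ((S \ T).card : ℝ) ≤ 2 * f := by
    have h : (S \ T).card ≤ Tᶜ.card := Finset.card_le_card fun j => by simp
    rw [Finset.card_compl, hTcard, Fintype.card_fin] at h
    exact_mod_cast h.trans (by omega)
  have hsum : ∑ j ∈ T, z j = ∑ j ∈ T \ S, z j - ∑ j ∈ S \ T, z j := by
    rw [Finset.sum_sdiff_sub_sum_sdiff, hzero, sub_zero]
  have hQV : ∑ j ∈ S \ T, z j ^ 2 ≤ ∑ j ∈ S, z j ^ 2 :=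
    Finset.sum_le_sum_of_subset_of_nonneg Finset.sdiff_subset fun _ _ _ => sq_nonneg _
  have hV : 0 ≤ ∑ j ∈ S, z j ^ 2 := Finset.sum_nonneg fun _ _ => sq_nonneg _
  have ha : (∑ j ∈ T \ S, z j) ^ 2 ≤ f * ∑ j ∈ S, z j ^ 2 :=
    sq_sum_le_card_mul_sum_sq.trans <|
      mul_le_mul hTS (hPQ.trans hQV) (Finset.sum_nonneg fun _ _ => sq_nonneg _) (by positivity)
  have hc : (∑ j ∈ S \ T, z j) ^ 2 ≤ 2 * f * ∑ j ∈ S, z j ^ 2 :=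
    sq_sum_le_card_mul_sum_sq.trans <|
      mul_le_mul hST hQV (Finset.sum_nonneg fun _ _ => sq_nonneg _) (by positivity)
  rw [hsum]
  linarith [sq_nonneg (2 * ∑ j ∈ T \ S, z j + ∑ j ∈ S \ T, z j)]

/-- The one-dimensional case of the robustness of the trimmed mean. -/
theorem sq_trimmedMean_sub_mean_le {n f : ℕ} (hf : 2 * f < n) {y : Fin n → ℝ}
    {σ : Equiv.Perm (Fin n)} (hσ : Monotone fun j => y (σ j))
    {S : Finset (Fin n)} (hS : S.card = n - f) :
    (((n : ℝ) - 2 * f)⁻¹ *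
        ∑ j ∈ Finset.univ.filter (fun j : Fin n => f ≤ (j : ℕ) ∧ (j : ℕ) < n - f), y (σ j) -
      (S.card : ℝ)⁻¹ * ∑ i ∈ S, y i) ^ 2 ≤
      ((6 * f / ((n : ℝ) - 2 * f)) * (1 + (f : ℝ) / ((n : ℝ) - 2 * f)) / (S.card : ℝ)) *
        ∑ i ∈ S, (y i - (S.card : ℝ)⁻¹ * ∑ j ∈ S, y j) ^ 2 := by
  have hfn : (2 * f : ℝ) < n := by exact_mod_cast hf
  have hScard : (S.card : ℝ) = n - f := by rw [hS, Nat.cast_sub (by omega)]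
  have hTcard : ((Finset.univ.filter
      (fun j : Fin n => f ≤ (j : ℕ) ∧ (j : ℕ) < n - f)).card : ℝ) = n - 2 * f := by
    rw [card_filter_kept hf, Nat.cast_sub hf.le]; push_cast; rfl
  have hN : (n : ℝ) - 2 * f ≠ 0 := by linarith
  have hf0 : (0 : ℝ) ≤ f := f.cast_nonneg
  have hM : (n : ℝ) - f ≠ 0 := by linarith
  set μ : ℝ := (S.card : ℝ)⁻¹ * ∑ i ∈ S, y i with hμ
  have hreindex : ∀ g : Fin n → ℝ,
      ∑ j ∈ S.map σ.symm.toEmbedding, g (σ j) = ∑ i ∈ S, g i := by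
    intro g; simp [Finset.sum_map]
  have hzero : ∑ j ∈ S.map σ.symm.toEmbedding, (y (σ j) - μ) = 0 := by
    rw [hreindex fun i => y i - μ, Finset.sum_sub_distrib, Finset.sum_const, nsmul_eq_mul, hμ,
      hScard]
    field_simp
    ring
  have hmain := sq_sum_kept_le hf (z := fun j => y (σ j) - μ)
    (fun a b hab => sub_le_sub_right (hσ hab) μ) (S := S.map σ.symm.toEmbedding)
    (by rw [Finset.card_map, hS]) hzero
  rw [hreindex fun i => (y i - μ) ^ 2, Finset.sum_sub_distrib, Finset.sum_const, nsmul_eq_mul,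
    hTcard] at hmain
  set A := ∑ j ∈ Finset.univ.filter (fun j : Fin n => f ≤ (j : ℕ) ∧ (j : ℕ) < n - f), y (σ j)
  have hleft : (((n : ℝ) - 2 * f)⁻¹ * A - μ) ^ 2 =
      (((n : ℝ) - 2 * f) ^ 2)⁻¹ * (A - ((n : ℝ) - 2 * f) * μ) ^ 2 := by
    field_simp
  have hκ : (6 * f / ((n : ℝ) - 2 * f)) * (1 + (f : ℝ) / ((n : ℝ) - 2 * f)) / (S.card : ℝ) =
      (((n : ℝ) - 2 * f) ^ 2)⁻¹ * (6 * f) := by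
    have hone : 1 + (f : ℝ) / ((n : ℝ) - 2 * f) = ((n : ℝ) - f) / ((n : ℝ) - 2 * f) := by
      rw [eq_div_iff hN, add_mul, div_mul_cancel₀ _ hN]
      ring
    rw [hScard, hone]
    field_simp
  rw [hleft, hκ, mul_assoc]
  exact mul_le_mul_of_nonneg_left hmain (by positivity)


/-- The coordinate-wise trimmed mean is `(f,κ)`-robust with
`κ = (6f/(n-2f)) (1 + f/(n-2f))`.  For each coordinate `k`, `τ k` is a permutation
sorting the `k`-th coordinates in non-decreasing order, and the vector `m` is the
coordinate-wise trimmed mean: its `k`-th coordinate averages the sorted values with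
(zero-based) indices in `{f, …, n-f-1}` (i.e. discarding the `f` smallest and `f`
largest values). -/
theorem cwtm_robust (n d f : ℕ) (hn : 0 < n) (hf : 2 * f < n)
    (x : Fin n → EuclideanSpace ℝ (Fin d))
    (τ : Fin d → Equiv.Perm (Fin n))
    (hτ : ∀ k : Fin d, Monotone (fun j : Fin n => x (τ k j) k))
    (m : EuclideanSpace ℝ (Fin d))
    (hm : ∀ k : Fin d, m k = ((n : ℝ) - 2 * f)⁻¹ *
      ∑ j ∈ Finset.univ.filter (fun j : Fin n => f ≤ (j : ℕ) ∧ (j : ℕ) < n - f), x (τ k j) k)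
    (S : Finset (Fin n)) (hS : S.card = n - f) :
    ‖m - (S.card : ℝ)⁻¹ • ∑ i ∈ S, x i‖ ^ 2 ≤
      ((6 * f / ((n : ℝ) - 2 * f)) * (1 + (f : ℝ) / ((n : ℝ) - 2 * f)) / (S.card : ℝ)) *
        ∑ i ∈ S, ‖x i - (S.card : ℝ)⁻¹ • ∑ j ∈ S, x j‖ ^ 2 := by
  have hcoord : ∀ k : Fin d, ((S.card : ℝ)⁻¹ • ∑ i ∈ S, x i) k =
      (S.card : ℝ)⁻¹ * ∑ i ∈ S, x i k := by
    intro k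
    simp
  simp only [EuclideanSpace.real_norm_sq_eq, PiLp.sub_apply, hcoord, hm]
  rw [Finset.sum_comm, Finset.mul_sum]
  exact Finset.sum_le_sum fun k _ =>
    sq_trimmedMean_sub_mean_le (y := fun i => x i k) hf (hτ k) hS
end

section
/- Let n be a positive integer and f an integer with 0 ≤ f < n/2. The Krum aggregation rule is (f,κ)-robust with κ = 6·(1 + f/(n−2f)). Precisely: for all x_1, …, x_n ∈ ℝ^d, for any choice, for each j ∈ {1,…,n}, of a set N_j ⊆ {1,…,n} with |N_j| = n − f consisting of indices of n − f nearest neighbors of x_j (i.e., for all i ∈ N_j and l ∉ N_j, ‖x_j − x_i‖ ≤ ‖x_j − x_l‖), for any k* ∈ argmin_{j ∈ {1,…,n}} Σ_{i ∈ N_j} ‖x_j − x_i‖², and for every S ⊆ {1,…,n} with |S| = n − f, it holds that ‖x_{k*} − x̄_S‖² ≤ (6·(1 + f/(n−2f)) / |S|) · Σ_{i∈S} ‖x_i − x̄_S‖², where x̄_S = (1/|S|) Σ_{i∈S} x_i. -/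
/-- A finset on which `g` takes its smallest values has the least sum of `g` among finsets of the
same cardinality. -/
theorem Finset.sum_le_sum_of_card_eq_of_forall_le {ι : Type*} [DecidableEq ι] {g : ι → ℝ}
    {A B : Finset ι} (hcard : A.card = B.card) (h : ∀ i ∈ A, ∀ l ∉ A, g i ≤ g l) :
    ∑ i ∈ A, g i ≤ ∑ i ∈ B, g i := by
  have hsdiff : (A \ B).card = (B \ A).card := by
    have h₁ := Finset.card_sdiff_add_card_inter A B
    have h₂ := Finset.card_sdiff_add_card_inter B A
    rw [Finset.inter_comm B A] at h₂
    omega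
  rw [← Finset.sum_inter_add_sum_sdiff A B, ← Finset.sum_inter_add_sum_sdiff B A,
    Finset.inter_comm B A]
  refine add_le_add_right ?_ _
  rcases (B \ A).eq_empty_or_nonempty with hBA | hBA
  · have hAB : A \ B = ∅ := by
      rw [← Finset.card_eq_zero, hsdiff, hBA, Finset.card_empty]
    rw [hAB, hBA]
  · obtain ⟨l, hl, hmin⟩ := Finset.exists_min_image (B \ A) g hBA
    calc ∑ i ∈ A \ B, g i ≤ (A \ B).card • g l :=
          Finset.sum_le_card_nsmul _ _ _ fun i hi =>
            h i (Finset.mem_sdiff.mp hi).1 l (Finset.mem_sdiff.mp hl).2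
      _ = (B \ A).card • g l := by rw [hsdiff]
      _ ≤ ∑ i ∈ B \ A, g i := Finset.card_nsmul_le_sum _ _ _ hmin

/-- The sum of all pairwise squared distances is twice the cardinality times the sum of squared
distances to the mean. -/
theorem sum_sum_norm_sub_sq_eq {ι E : Type*} [NormedAddCommGroup E] [InnerProductSpace ℝ E]
    (S : Finset ι) (x : ι → E) :
    ∑ j ∈ S, ∑ i ∈ S, ‖x j - x i‖ ^ 2 =
      2 * S.card * ∑ i ∈ S, ‖x i - (S.card : ℝ)⁻¹ • ∑ j ∈ S, x j‖ ^ 2 := by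
  rcases S.eq_empty_or_nonempty with rfl | hS
  · simp
  set c := (S.card : ℝ)⁻¹ • ∑ j ∈ S, x j with hc
  have hcard : (S.card : ℝ) ≠ 0 := by exact_mod_cast hS.card_ne_zero
  have hzero : ∑ i ∈ S, (x i - c) = 0 := by
    rw [Finset.sum_sub_distrib, Finset.sum_const, ← Nat.cast_smul_eq_nsmul ℝ, hc,
      smul_inv_smul₀ hcard, sub_self]
  have hexp : ∀ j i, ‖x j - x i‖ ^ 2 =
      ‖x j - c‖ ^ 2 - 2 * inner ℝ (x j - c) (x i - c) + ‖x i - c‖ ^ 2 := fun j i => by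
    rw [← norm_sub_sq_real, sub_sub_sub_cancel_right]
  simp_rw [hexp, Finset.sum_add_distrib, Finset.sum_sub_distrib, ← Finset.mul_sum, ← inner_sum,
    hzero, inner_zero_right, Finset.sum_const, nsmul_eq_mul, ← Finset.mul_sum]
  ring


/-- Krum is `(f,κ)`-robust with `κ = 6 (1 + f/(n-2f))`: if `k` minimizes the sum of
squared distances to its `n - f` nearest neighbors `N j`, then for every `S` of size
`n - f`, `‖x k - x̄_S‖² ≤ (κ/|S|) ∑_{i ∈ S} ‖x i - x̄_S‖²`. -/
theorem krum_robust (n d f : ℕ) (hn : 0 < n) (hf : 2 * f < n)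
    (x : Fin n → EuclideanSpace ℝ (Fin d))
    (N : Fin n → Finset (Fin n))
    (hNcard : ∀ j, (N j).card = n - f)
    (hNnear : ∀ j : Fin n, ∀ i ∈ N j, ∀ l ∉ N j, ‖x j - x i‖ ≤ ‖x j - x l‖)
    (k : Fin n)
    (hk : ∀ j : Fin n, ∑ i ∈ N k, ‖x k - x i‖ ^ 2 ≤ ∑ i ∈ N j, ‖x j - x i‖ ^ 2)
    (S : Finset (Fin n)) (hS : S.card = n - f) :
    ‖x k - (S.card : ℝ)⁻¹ • ∑ i ∈ S, x i‖ ^ 2 ≤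
      (6 * (1 + (f : ℝ) / ((n : ℝ) - 2 * f)) / (S.card : ℝ)) *
        ∑ i ∈ S, ‖x i - (S.card : ℝ)⁻¹ • ∑ j ∈ S, x j‖ ^ 2 := by
  set c := (S.card : ℝ)⁻¹ • ∑ i ∈ S, x i with hc
  set V := ∑ i ∈ S, ‖x i - c‖ ^ 2 with hV
  have hm : (0 : ℝ) < S.card := by
    have : 0 < S.card := by omega
    exact_mod_cast this
  have hmcast : (S.card : ℝ) = n - f := by rw [hS, Nat.cast_sub (by omega)]
  have hq : (0 : ℝ) < n - 2 * f := by
    have : (2 * f : ℝ) < n := by exact_mod_cast hf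
    linarith
  have hscore : ∑ i ∈ N k, ‖x k - x i‖ ^ 2 ≤ 2 * V := by
    have hle : ∀ j ∈ S, ∑ i ∈ N k, ‖x k - x i‖ ^ 2 ≤ ∑ i ∈ S, ‖x j - x i‖ ^ 2 := fun j _ =>
      (hk j).trans <| Finset.sum_le_sum_of_card_eq_of_forall_le ((hNcard j).trans hS.symm)
        fun i hi l hl => pow_le_pow_left₀ (norm_nonneg _) (hNnear j i hi l hl) 2
    have hsum := Finset.card_nsmul_le_sum _ _ _ hle
    rw [sum_sum_norm_sub_sq_eq, nsmul_eq_mul, ← hc, ← hV] at hsum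
    exact le_of_mul_le_mul_left (by linarith) hm
  have hcardT : (n : ℝ) - 2 * f ≤ (N k ∩ S).card := by
    have hunion := Finset.card_union_add_card_inter (N k) S
    have hle : (N k ∪ S).card ≤ n := by simpa using Finset.card_le_univ (N k ∪ S)
    have : n ≤ (N k ∩ S).card + 2 * f := by rw [hNcard, hS] at hunion; omega
    have : (n : ℝ) ≤ (N k ∩ S).card + 2 * f := by exact_mod_cast this
    linarith
  have htri : ∀ i, ‖x k - c‖ ^ 2 ≤ 2 * ‖x k - x i‖ ^ 2 + 2 * ‖x i - c‖ ^ 2 := fun i => by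
    have h := norm_sub_le_norm_sub_add_norm_sub (x k) (x i) c
    nlinarith [norm_nonneg (x k - c), sq_nonneg (‖x k - x i‖ - ‖x i - c‖)]
  have hmain : ((n : ℝ) - 2 * f) * ‖x k - c‖ ^ 2 ≤ 6 * V := by
    calc ((n : ℝ) - 2 * f) * ‖x k - c‖ ^ 2 ≤ (N k ∩ S).card * ‖x k - c‖ ^ 2 := by gcongr
      _ = ∑ i ∈ N k ∩ S, ‖x k - c‖ ^ 2 := by rw [Finset.sum_const, nsmul_eq_mul]
      _ ≤ ∑ i ∈ N k ∩ S, (2 * ‖x k - x i‖ ^ 2 + 2 * ‖x i - c‖ ^ 2) :=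
          Finset.sum_le_sum fun i _ => htri i
      _ = 2 * ∑ i ∈ N k ∩ S, ‖x k - x i‖ ^ 2 + 2 * ∑ i ∈ N k ∩ S, ‖x i - c‖ ^ 2 := by
          rw [Finset.sum_add_distrib, Finset.mul_sum, Finset.mul_sum]
      _ ≤ 2 * ∑ i ∈ N k, ‖x k - x i‖ ^ 2 + 2 * V := by
          gcongr
          · exact Finset.inter_subset_left
          · exact Finset.sum_le_sum_of_subset_of_nonneg Finset.inter_subset_right
              fun _ _ _ => sq_nonneg _
      _ ≤ 6 * V := by linarith
  have hcoef : 6 * (1 + (f : ℝ) / (n - 2 * f)) / S.card = 6 / (n - 2 * f) := by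
    rw [hmcast] at hm ⊢
    rw [one_add_div hq.ne', mul_div_assoc', div_div, div_eq_div_iff (mul_pos hq hm).ne' hq.ne']
    ring
  rw [hcoef, div_mul_eq_mul_div, le_div_iff₀ hq]
  linarith
end

section
/- Let n be a positive integer and f an integer with 0 ≤ f < n/2. The geometric median GM is (f,κ)-robust with κ = 4·(1 + f/(n−2f))². Precisely: for all x_1, …, x_n ∈ ℝ^d, for any x* minimizing y ↦ Σ_{i=1}^n ‖y − x_i‖ over ℝ^d, and for every S ⊆ {1,…,n} with |S| = n − f, it holds that ‖x* − x̄_S‖² ≤ (4·(1 + f/(n−2f))² / |S|) · Σ_{i∈S} ‖x_i − x̄_S‖², where x̄_S = (1/|S|) Σ_{i∈S} x_i. -/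
/-- A point whose total distance to the `x i` is at most that of `m` is close to `m`, as measured by
the distances from `m` to any strict majority `S` of the `x i`. -/
theorem card_sub_card_compl_mul_norm_sub_le {ι E : Type*} [Fintype ι] [DecidableEq ι]
    [SeminormedAddCommGroup E] (x : ι → E) {z m : E}
    (h : ∑ i, ‖z - x i‖ ≤ ∑ i, ‖m - x i‖) (S : Finset ι) :
    ((S.card : ℝ) - (Sᶜ.card : ℝ)) * ‖z - m‖ ≤ 2 * ∑ i ∈ S, ‖x i - m‖ := by
  have h_in : ∑ i ∈ S, (‖z - m‖ - ‖x i - m‖) ≤ ∑ i ∈ S, ‖z - x i‖ := by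
    refine Finset.sum_le_sum fun i _ => ?_
    have := norm_sub_le_norm_sub_add_norm_sub z (x i) m
    linarith
  have h_out : ∑ i ∈ Sᶜ, (‖m - x i‖ - ‖z - m‖) ≤ ∑ i ∈ Sᶜ, ‖z - x i‖ := by
    refine Finset.sum_le_sum fun i _ => ?_
    have := norm_sub_le_norm_sub_add_norm_sub m z (x i)
    rw [norm_sub_rev m z] at this
    linarith
  rw [← Finset.sum_add_sum_compl S, ← Finset.sum_add_sum_compl S (fun i => ‖m - x i‖)] at h
  simp only [Finset.sum_sub_distrib, Finset.sum_const, nsmul_eq_mul] at h_in h_out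
  simp only [norm_sub_rev m] at h h_out
  linarith


/-- The geometric median is `(f,κ)`-robust with `κ = 4 (1 + f/(n-2f))²`. -/
theorem gm_robust (n d f : ℕ) (hn : 0 < n) (hf : 2 * f < n)
    (x : Fin n → EuclideanSpace ℝ (Fin d))
    (xstar : EuclideanSpace ℝ (Fin d))
    (hmin : ∀ y : EuclideanSpace ℝ (Fin d),
      ∑ i, ‖xstar - x i‖ ≤ ∑ i, ‖y - x i‖)
    (S : Finset (Fin n)) (hS : S.card = n - f) :
    ‖xstar - (S.card : ℝ)⁻¹ • ∑ i ∈ S, x i‖ ^ 2 ≤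
      (4 * (1 + (f : ℝ) / ((n : ℝ) - 2 * f)) ^ 2 / (S.card : ℝ)) *
        ∑ i ∈ S, ‖x i - (S.card : ℝ)⁻¹ • ∑ j ∈ S, x j‖ ^ 2 := by
  set m := (S.card : ℝ)⁻¹ • ∑ i ∈ S, x i
  have h_card : (S.card : ℝ) = n - f := by rw [hS, Nat.cast_sub (by lia)]
  have h_compl : (Sᶜ.card : ℝ) = f := by
    rw [Finset.card_compl, hS, Fintype.card_fin, Nat.sub_sub_self (by lia)]
  have h_gap : (0 : ℝ) < n - 2 * f := by
    rw [sub_pos]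
    exact_mod_cast hf
  have h_card_pos : (0 : ℝ) < S.card := by
    rw [h_card]
    linarith [f.cast_nonneg (α := ℝ)]
  have h_dist : ((n : ℝ) - 2 * f) * ‖xstar - m‖ ≤ 2 * ∑ i ∈ S, ‖x i - m‖ := by
    have := card_sub_card_compl_mul_norm_sub_le x (hmin m) S
    rw [h_card, h_compl] at this
    linarith
  have h_sq : (((n : ℝ) - 2 * f) * ‖xstar - m‖) ^ 2 ≤
      4 * (S.card * ∑ i ∈ S, ‖x i - m‖ ^ 2) := calc
    _ ≤ (2 * ∑ i ∈ S, ‖x i - m‖) ^ 2 := by gcongr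
    _ = 4 * (∑ i ∈ S, ‖x i - m‖) ^ 2 := by ring
    _ ≤ _ := by
      gcongr
      exact sq_sum_le_card_mul_sum_sq
  have h_ratio : 1 + (f : ℝ) / (n - 2 * f) = S.card / (n - 2 * f) := by
    rw [h_card, one_add_div h_gap.ne']
    ring
  rw [h_ratio]
  calc ‖xstar - m‖ ^ 2
      ≤ 4 * (S.card * ∑ i ∈ S, ‖x i - m‖ ^ 2) / ((n : ℝ) - 2 * f) ^ 2 := by
        rw [le_div_iff₀ (by positivity)]
        linarith
    _ = _ := by field_simp
end
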